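/- (Proposition on the lower bound, part 2.) For every matrix game u : Fin m → Fin n → ℝ with entries in {0,1}, floor(u) ≤ 𝒱(u). -/

import Mathlib

open Finset

/-- A mixed strategy over a finite index type: nonnegative weights summing to 1. -/
def IsMixed {α : Type*} [Fintype α] (μ : α → ℝ) : Prop :=
  (∀ i, 0 ≤ μ i) ∧ ∑ i, μ i = 1

/-- Expected utility for Eloise when she plays mixed strategy `μ` (rows)
and Abelard plays mixed strategy `ν` (columns) in the matrix game `u`. -/
noncomputable def EU {α β : Type*} [Fintype α] [Fintype β]
    (u : α → β → ℝ) (μ : α → ℝ) (ν : β → ℝ) : ℝ :=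
  ∑ i, ∑ j, μ i * ν j * u i j

/-- The value of the matrix game `u`:
sup over Eloise's mixed strategies of the inf over Abelard's mixed strategies
of the expected utility. -/
noncomputable def gameValue {α β : Type*} [Fintype α] [Fintype β]
    (u : α → β → ℝ) : ℝ :=
  ⨆ μ : {μ : α → ℝ // IsMixed μ}, ⨅ ν : {ν : β → ℝ // IsMixed ν}, EU u μ.1 ν.1

section IsMixed

variable {α β : Type*} [Fintype α] [Fintype β]

lemma isMixed_uniform [Nonempty α] : IsMixed fun _ : α => (Fintype.card α : ℝ)⁻¹ :=
  ⟨fun _ => by positivity, by simp⟩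

lemma IsMixed.sum_sum_mul {μ : α → ℝ} {ν : β → ℝ} (hμ : IsMixed μ) (hν : IsMixed ν) :
    ∑ i, ∑ j, μ i * ν j = 1 := by
  rw [← Finset.sum_mul_sum, hμ.2, hν.2, one_mul]

lemma EU_nonneg {u : α → β → ℝ} (hu : ∀ i j, 0 ≤ u i j) {μ : α → ℝ} {ν : β → ℝ}
    (hμ : IsMixed μ) (hν : IsMixed ν) : 0 ≤ EU u μ ν :=
  Finset.sum_nonneg fun i _ => Finset.sum_nonneg fun j _ =>
    mul_nonneg (mul_nonneg (hμ.1 i) (hν.1 j)) (hu i j)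

lemma EU_le_one {u : α → β → ℝ} (hu : ∀ i j, u i j ≤ 1) {μ : α → ℝ} {ν : β → ℝ}
    (hμ : IsMixed μ) (hν : IsMixed ν) : EU u μ ν ≤ 1 := by
  rw [← hμ.sum_sum_mul hν]
  exact Finset.sum_le_sum fun i _ => Finset.sum_le_sum fun j _ =>
    mul_le_of_le_one_right (mul_nonneg (hμ.1 i) (hν.1 j)) (hu i j)

/-- A guarantee against every pure strategy is a guarantee against every mixed strategy. -/
lemma le_EU_of_forall_le {u : α → β → ℝ} {μ : α → ℝ} {ν : β → ℝ} {c : ℝ}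
    (hc : ∀ j, c ≤ ∑ i, μ i * u i j) (hν : IsMixed ν) : c ≤ EU u μ ν := by
  calc c = ∑ j, ν j * c := by rw [← Finset.sum_mul, hν.2, one_mul]
    _ ≤ ∑ j, ν j * ∑ i, μ i * u i j :=
      Finset.sum_le_sum fun j _ => mul_le_mul_of_nonneg_left (hc j) (hν.1 j)
    _ = EU u μ ν := by
      rw [EU, Finset.sum_comm]
      refine Finset.sum_congr rfl fun j _ => ?_
      rw [Finset.mul_sum]
      exact Finset.sum_congr rfl fun i _ => by ring

/-- In a game with payoffs in `[0, 1]`, what a mixed strategy guarantees against every pure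
strategy is a lower bound for the value. -/
lemma le_gameValue [Nonempty β] {u : α → β → ℝ} (hu₀ : ∀ i j, 0 ≤ u i j)
    (hu₁ : ∀ i j, u i j ≤ 1) {μ : α → ℝ} (hμ : IsMixed μ) {c : ℝ}
    (hc : ∀ j, c ≤ ∑ i, μ i * u i j) : c ≤ gameValue u := by
  have : Nonempty {ν : β → ℝ // IsMixed ν} := ⟨⟨_, isMixed_uniform⟩⟩
  have hbdd : BddAbove (Set.range fun μ : {μ : α → ℝ // IsMixed μ} =>
      ⨅ ν : {ν : β → ℝ // IsMixed ν}, EU u μ.1 ν.1) := by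
    refine ⟨1, Set.forall_mem_range.2 fun μ => ?_⟩
    have hbelow : BddBelow (Set.range fun ν : {ν : β → ℝ // IsMixed ν} => EU u μ.1 ν.1) :=
      ⟨0, Set.forall_mem_range.2 fun ν => EU_nonneg hu₀ μ.2 ν.2⟩
    exact (ciInf_le hbelow ⟨_, isMixed_uniform⟩).trans (EU_le_one hu₁ μ.2 isMixed_uniform)
  exact le_ciSup_of_le hbdd ⟨μ, hμ⟩ (le_ciInf fun ν => le_EU_of_forall_le hc ν.2)

end IsMixed

/-- `floor(u) ≤ 𝒱(u)`: the minimal column sum divided by the number of rows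
is a lower bound for the value of the game. -/
theorem floor_le_value (m n : ℕ) (hm : 1 ≤ m) (hn : 1 ≤ n)
    (u : Fin m → Fin n → ℝ) (hu : ∀ i j, u i j = 0 ∨ u i j = 1) :
    (⨅ j : Fin n, ∑ i, u i j) / m ≤ gameValue u := by
  have : Nonempty (Fin m) := ⟨⟨0, hm⟩⟩
  have : Nonempty (Fin n) := ⟨⟨0, hn⟩⟩
  refine le_gameValue (fun i j => ?_) (fun i j => ?_) isMixed_uniform fun j => ?_
  · rcases hu i j with h | h <;> simp [h]
  · rcases hu i j with h | h <;> simp [h]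
  · rw [← Finset.mul_sum, Fintype.card_fin, div_eq_inv_mul]
    exact mul_le_mul_of_nonneg_left (ciInf_le (Set.finite_range _).bddBelow j) (by positivity)
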